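/- Let L_d : ℝⁿ × ℝ × ℝⁿ × ℝ → ℝ be C¹ with arguments (q₀,𝔮₀,q₁,𝔮₁), let g : ℝ → ℝ be C¹, let 0 = τ₀ < τ₁ < ⋯ < τ_N = 𝒯 be a partition, and consider a discrete curve {(q_k,𝔮_k,λ_k)}_{k=0}^N in ℝⁿ × ℝ × ℝ. Define the discrete action 𝔖_d = Σ_{k=0}^{N−1} { (𝔮_{k+1}−𝔮_k)/(τ_{k+1}−τ_k) · [ L_d(q_k,𝔮_k,q_{k+1},𝔮_{k+1}) − λ_k ] + λ_k g(𝔮_k) }. Then the partial derivatives of 𝔖_d with respect to all interior variables q_k and 𝔮_k (1 ≤ k ≤ N−1) and with respect to all multipliers λ_k (0 ≤ k ≤ N−1) vanish if and only if: (i) 𝔮_{k+1} = 𝔮_k + (τ_{k+1}−τ_k) g(𝔮_k) for 0 ≤ k ≤ N−1; (ii) ((𝔮_{k+1}−𝔮_k)/(τ_{k+1}−τ_k)) D₁L_d(q_k,𝔮_k,q_{k+1},𝔮_{k+1}) + ((𝔮_k−𝔮_{k−1})/(τ_k−τ_{k−1})) D₃L_d(q_{k−1},𝔮_{k−1},q_k,𝔮_k)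 = 0 for 1 ≤ k ≤ N−1; and (iii) ((𝔮_{k+1}−𝔮_k)/(τ_{k+1}−τ_k)) D₂L_{d_k} − L_{d_k}/(τ_{k+1}−τ_k) + ((𝔮_k−𝔮_{k−1})/(τ_k−τ_{k−1})) D₄L_{d_{k−1}} + L_{d_{k−1}}/(τ_k−τ_{k−1}) = λ_{k−1}/(τ_k−τ_{k−1}) − λ_k/(τ_{k+1}−τ_k) − λ_k g'(𝔮_k) for 1 ≤ k ≤ N−1, where L_{d_k} denotes L_d(q_k,𝔮_k,q_{k+1},𝔮_{k+1}) and D_i denotes the partial derivative with respect to the i-th argument. -/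

import Mathlib

open Finset in
/-- A finite sum only one of whose terms depends on the variable. -/
theorem hasDerivAt_sum_range_of_single {f : ℕ → ℝ → ℝ} {N m : ℕ} {a x : ℝ} (hm : m < N)
    (ha : HasDerivAt (f m) a x) (hconst : ∀ j, j ≠ m → ∀ y, f j y = f j x) :
    HasDerivAt (fun y => ∑ j ∈ range N, f j y) a x := by
  have hsum : HasDerivAt (fun y => ∑ j ∈ range N, f j y)
      (∑ j ∈ range N, if j = m then a else 0) x := by
    refine HasDerivAt.fun_sum fun j _ => ?_
    split_ifs with hj
    · exact hj ▸ ha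
    · rw [show f j = fun _ => f j x from funext (hconst j hj)]
      exact hasDerivAt_const _ _
  simpa [hm] using hsum

open Finset in
/-- A finite sum only two consecutive terms of which depend on the variable. -/
theorem hasDerivAt_sum_range_of_pair {f : ℕ → ℝ → ℝ} {N m : ℕ} {a b x : ℝ} (hm : m + 1 < N)
    (ha : HasDerivAt (f m) a x) (hb : HasDerivAt (f (m + 1)) b x)
    (hconst : ∀ j, j ≠ m → j ≠ m + 1 → ∀ y, f j y = f j x) :
    HasDerivAt (fun y => ∑ j ∈ range N, f j y) (a + b) x := by
  have hsum : HasDerivAt (fun y => ∑ j ∈ range N, f j y)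
      (∑ j ∈ range N, ((if j = m then a else 0) + if j = m + 1 then b else 0)) x := by
    refine HasDerivAt.fun_sum fun j _ => ?_
    by_cases hj : j = m
    · subst hj; simpa using ha
    · by_cases hj' : j = m + 1
      · subst hj'; simpa using hb
      · rw [show f j = fun _ => f j x from funext (hconst j hj hj')]
        simpa [hj, hj'] using hasDerivAt_const x (f j x)
  simpa [sum_add_distrib, hm, Nat.lt_of_succ_lt hm] using hsum

/-- A derivative along a line through `x`. -/
theorem DifferentiableAt.hasDerivAt_add_smul {E : Type*} [NormedAddCommGroup E] [NormedSpace ℝ E]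
    {f : E → ℝ} {x : E} (hf : DifferentiableAt ℝ f x) (v : E) :
    HasDerivAt (fun ε : ℝ => f (x + ε • v)) (fderiv ℝ f x v) 0 := by
  have hline : HasDerivAt (fun ε : ℝ => x + ε • v) v 0 := by
    simpa using ((hasDerivAt_id (0 : ℝ)).smul_const v).const_add x
  exact HasFDerivAt.comp_hasDerivAt (0 : ℝ) (by simpa using hf.hasFDerivAt) hline

theorem HasDerivAt.iff_eq_of_hasDerivAt {f : ℝ → ℝ} {a b x : ℝ} (h : HasDerivAt f a x) :
    HasDerivAt f b x ↔ a = b :=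
  ⟨h.unique, fun hab => hab ▸ h⟩

/-- Second time-adaptive discrete framework: the discrete Hamilton's variational principle
(vanishing of all partial derivatives of the discrete action
`𝔖_d = Σ_k { (𝔮_{k+1}−𝔮_k)/(τ_{k+1}−τ_k) · [L_d(q_k,𝔮_k,q_{k+1},𝔮_{k+1}) − λ_k] + λ_k g(𝔮_k) }`
with respect to interior `q_k`, `𝔮_k` and all `λ_k`) is equivalent to the discrete extended
Euler–Lagrange equations (i)–(iii). -/
theorem adaptive_discrete_EL_second_framework {n N : ℕ} (hN : 0 < N) (𝒯 : ℝ)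
    (Ld : (Fin n → ℝ) → ℝ → (Fin n → ℝ) → ℝ → ℝ)
    (hLd : ContDiff ℝ 1 fun x : (Fin n → ℝ) × ℝ × (Fin n → ℝ) × ℝ =>
      Ld x.1 x.2.1 x.2.2.1 x.2.2.2)
    (g : ℝ → ℝ) (hg : ContDiff ℝ 1 g)
    (τ : ℕ → ℝ) (hτ0 : τ 0 = 0) (hτN : τ N = 𝒯) (hτmono : ∀ k < N, τ k < τ (k + 1))
    (q : ℕ → Fin n → ℝ) (𝔮 lam : ℕ → ℝ)
    (Sd : (ℕ → Fin n → ℝ) → (ℕ → ℝ) → (ℕ → ℝ) → ℝ)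
    (hSd : ∀ Q Qf Lam, Sd Q Qf Lam = ∑ k ∈ Finset.range N,
      (((Qf (k + 1) - Qf k) / (τ (k + 1) - τ k))
          * (Ld (Q k) (Qf k) (Q (k + 1)) (Qf (k + 1)) - Lam k)
        + Lam k * g (Qf k))) :
    ((∀ k, 1 ≤ k → k < N → ∀ i : Fin n,
        HasDerivAt (fun ε : ℝ =>
          Sd (Function.update q k (q k + ε • (Pi.single i 1 : Fin n → ℝ))) 𝔮 lam) 0 0) ∧
     (∀ k, 1 ≤ k → k < N →
        HasDerivAt (fun ε : ℝ => Sd q (Function.update 𝔮 k (𝔮 k + ε)) lam) 0 0) ∧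
     (∀ k, k < N →
        HasDerivAt (fun ε : ℝ => Sd q 𝔮 (Function.update lam k (lam k + ε))) 0 0))
    ↔
    ((∀ k, k < N → 𝔮 (k + 1) = 𝔮 k + (τ (k + 1) - τ k) * g (𝔮 k)) ∧
     (∀ k, 1 ≤ k → k < N → ∀ i : Fin n,
        ((𝔮 (k + 1) - 𝔮 k) / (τ (k + 1) - τ k)) *
          fderiv ℝ (fun a => Ld a (𝔮 k) (q (k + 1)) (𝔮 (k + 1))) (q k) (Pi.single i 1)
        + ((𝔮 k - 𝔮 (k - 1)) / (τ k - τ (k - 1))) *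
          fderiv ℝ (fun c => Ld (q (k - 1)) (𝔮 (k - 1)) c (𝔮 k)) (q k) (Pi.single i 1)
        = 0) ∧
     (∀ k, 1 ≤ k → k < N →
        ((𝔮 (k + 1) - 𝔮 k) / (τ (k + 1) - τ k)) *
            deriv (fun b => Ld (q k) b (q (k + 1)) (𝔮 (k + 1))) (𝔮 k)
          - Ld (q k) (𝔮 k) (q (k + 1)) (𝔮 (k + 1)) / (τ (k + 1) - τ k)
          + ((𝔮 k - 𝔮 (k - 1)) / (τ k - τ (k - 1))) *
            deriv (fun e => Ld (q (k - 1)) (𝔮 (k - 1)) (q k) e) (𝔮 k)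
          + Ld (q (k - 1)) (𝔮 (k - 1)) (q k) (𝔮 k) / (τ k - τ (k - 1))
        = lam (k - 1) / (τ k - τ (k - 1)) - lam k / (τ (k + 1) - τ k)
            - lam k * deriv g (𝔮 k))) := by
  have hL : Differentiable ℝ fun x : (Fin n → ℝ) × ℝ × (Fin n → ℝ) × ℝ =>
      Ld x.1 x.2.1 x.2.2.1 x.2.2.2 := hLd.differentiable one_ne_zero
  have hgd : Differentiable ℝ g := hg.differentiable one_ne_zero
  have hD₁ : ∀ b c e, Differentiable ℝ fun a => Ld a b c e := fun b c e =>
    hL.comp (g := fun x : (Fin n → ℝ) × ℝ × (Fin n → ℝ) × ℝ => Ld x.1 x.2.1 x.2.2.1 x.2.2.2)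
      (f := fun a => (a, b, c, e)) (by fun_prop)
  have hD₂ : ∀ a c e, Differentiable ℝ fun b => Ld a b c e := fun a c e =>
    hL.comp (g := fun x : (Fin n → ℝ) × ℝ × (Fin n → ℝ) × ℝ => Ld x.1 x.2.1 x.2.2.1 x.2.2.2)
      (f := fun b => (a, b, c, e)) (by fun_prop)
  have hD₃ : ∀ a b e, Differentiable ℝ fun c => Ld a b c e := fun a b e =>
    hL.comp (g := fun x : (Fin n → ℝ) × ℝ × (Fin n → ℝ) × ℝ => Ld x.1 x.2.1 x.2.2.1 x.2.2.2)
      (f := fun c => (a, b, c, e)) (by fun_prop)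
  have hD₄ : ∀ a b c, Differentiable ℝ fun e => Ld a b c e := fun a b c =>
    hL.comp (g := fun x : (Fin n → ℝ) × ℝ × (Fin n → ℝ) × ℝ => Ld x.1 x.2.1 x.2.2.1 x.2.2.2)
      (f := fun e => (a, b, c, e)) (by fun_prop)
  have hshift : HasDerivAt (fun ε : ℝ => ε) 1 0 := hasDerivAt_id 0
  simp only [hSd]
  rw [← and_assoc, and_comm]
  refine and_congr (forall₂_congr fun k hk => ?_) (and_congr
    (forall₃_congr fun k hk1 hk => forall_congr' fun i => ?_)
    (forall₃_congr fun k hk1 hk => ?_))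
  · have hτ : τ (k + 1) - τ k ≠ 0 := (sub_pos.2 (hτmono k hk)).ne'
    have hlam : HasDerivAt (fun ε : ℝ => lam k + ε) 1 0 := hshift.const_add _
    rw [(hasDerivAt_sum_range_of_single hk (a := (𝔮 (k + 1) - 𝔮 k) / (τ (k + 1) - τ k) * (-1)
      + 1 * g (𝔮 k)) ?_ ?_).iff_eq_of_hasDerivAt]
    · field_simp
      constructor <;> intro h <;> linarith
    · simp only [Function.update_self]
      exact ((hlam.const_sub _).const_mul _).add (hlam.mul_const _)
    · intro j hj ε
      simp [Function.update_of_ne hj]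
  · obtain ⟨m, rfl⟩ : ∃ m, k = m + 1 := ⟨k - 1, by omega⟩
    simp only [Nat.add_sub_cancel]
    rw [(hasDerivAt_sum_range_of_pair hk
      (((((hD₃ (q m) (𝔮 m) (𝔮 (m + 1))) (q (m + 1))).hasDerivAt_add_smul
        (Pi.single i 1)).sub_const (lam m)).const_mul
          ((𝔮 (m + 1) - 𝔮 m) / (τ (m + 1) - τ m))
          |>.add_const (lam m * g (𝔮 m)) |>.congr_of_eventuallyEq
          (.of_forall fun ε => ?_))
      (((((hD₁ (𝔮 (m + 1)) (q (m + 2)) (𝔮 (m + 2))) (q (m + 1))).hasDerivAt_add_smul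
        (Pi.single i 1)).sub_const (lam (m + 1))).const_mul
          ((𝔮 (m + 2) - 𝔮 (m + 1)) / (τ (m + 2) - τ (m + 1)))
          |>.add_const (lam (m + 1) * g (𝔮 (m + 1))) |>.congr_of_eventuallyEq
          (.of_forall fun ε => ?_)) ?_).iff_eq_of_hasDerivAt, add_comm]
    · intro j hj hj' ε
      have hne : j + 1 ≠ m + 1 := by omega
      simp [Function.update_of_ne hj', Function.update_of_ne hne]
    · simp
    · simp
  · obtain ⟨m, rfl⟩ : ∃ m, k = m + 1 := ⟨k - 1, by omega⟩
    simp only [Nat.add_sub_cancel]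
    have hline : HasDerivAt (fun ε : ℝ => 𝔮 (m + 1) + ε) 1 0 := hshift.const_add _
    have hcomp : ∀ {f : ℝ → ℝ}, Differentiable ℝ f →
        HasDerivAt (fun ε : ℝ => f (𝔮 (m + 1) + ε)) (deriv f (𝔮 (m + 1))) 0 := fun hf => by
      simpa using (hf (𝔮 (m + 1) + 0)).hasDerivAt.comp_const_add (𝔮 (m + 1)) 0
    rw [(hasDerivAt_sum_range_of_pair hk
      ((((hline.sub_const (𝔮 m)).div_const (τ (m + 1) - τ m)).mul
        ((hcomp (hD₄ (q m) (𝔮 m) (q (m + 1)))).sub_const (lam m))).add_const (lam m * g (𝔮 m))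
          |>.congr_of_eventuallyEq (.of_forall fun ε => ?_))
      ((((hline.const_sub (𝔮 (m + 2))).div_const (τ (m + 2) - τ (m + 1))).mul
        ((hcomp (hD₂ (q (m + 1)) (q (m + 2)) (𝔮 (m + 2)))).sub_const (lam (m + 1)))).add
          ((hcomp hgd).const_mul (lam (m + 1)))
          |>.congr_of_eventuallyEq (.of_forall fun ε => ?_)) ?_).iff_eq_of_hasDerivAt]
    · simp only [add_zero, div_eq_mul_inv]
      constructor <;> intro h <;> linear_combination h
    · intro j hj hj' ε
      have hne : j + 1 ≠ m + 1 := by omega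
      simp [Function.update_of_ne hj', Function.update_of_ne hne]
    · simp
    · simp
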